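/- arXiv:2202.04537 — 9 statements merged into one kernel-verified Lean document; each statement's English description precedes it below -/
import Mathlib

section
/- Let a > 0, θ ∈ [0,1] and τ > 0 satisfy (1−θ)·a·τ < 1, and let N_t ≥ 2. Set s₁ = 1 − (1−θ)aτ and s₂ = 1 + θaτ, and let A be the N_t×N_t real lower-bidiagonal matrix with s₂ on the main diagonal, −s₁ on the first subdiagonal, and 0 elsewhere. Then every singular value σ of A satisfies aτ ≤ σ ≤ 2 + |2θ−1|·aτ. Consequently the spectral condition number of A is at most (2 + |2θ−1|·aτ)/(aτ). -/
open Matrix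

noncomputable def specNorm {𝕜 : Type*} [RCLike 𝕜] {m n : Type*} [Fintype m] [Fintype n]
    [DecidableEq n] (M : Matrix m n 𝕜) : ℝ :=
  ‖(Matrix.toEuclideanLin M).toContinuousLinearMap‖

def IsSingularValue {𝕜 : Type*} [RCLike 𝕜] {n : Type*} [Fintype n] [DecidableEq n]
    (M : Matrix n n 𝕜) (σ : ℝ) : Prop :=
  0 ≤ σ ∧ algebraMap ℝ 𝕜 (σ ^ 2) ∈ spectrum 𝕜 (M * Mᴴ)

/-- The `θ`-scheme matrix for the ODE `u' = -a u`: lower bidiagonal with `s₂ = 1 + θaτ`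
on the diagonal and `-s₁ = -(1 - (1-θ)aτ)` on the first subdiagonal. -/
def thetaSchemeMatrix (Nt : ℕ) (s₁ s₂ : ℝ) : Matrix (Fin Nt) (Fin Nt) ℝ :=
  fun i j => if i = j then s₂ else if (i : ℕ) = (j : ℕ) + 1 then -s₁ else 0

open scoped Matrix.Norms.L2Operator in
theorem specNorm_eq_norm {m n : Type*} [Fintype m] [Fintype n] [DecidableEq n]
    (M : Matrix m n ℝ) : specNorm M = ‖M‖ := by
  rw [specNorm, Matrix.l2_opNorm_def]
  rfl

open scoped Matrix.Norms.L2Operator in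
theorem IsSingularValue.le_norm {n : Type*} [Fintype n] [DecidableEq n] [Nonempty n]
    {M : Matrix n n ℝ} {σ : ℝ} (h : IsSingularValue M σ) : σ ≤ ‖M‖ := by
  have h1 := spectrum.norm_le_norm_of_mem h.2
  have h2 : ‖M * Mᴴ‖ = ‖M‖ * ‖M‖ := by
    simpa [star_eq_conjTranspose] using CStarRing.norm_self_mul_star (x := M)
  rw [h2, ← sq] at h1
  simp only [Algebra.algebraMap_self, RingHom.id_apply, norm_pow, Real.norm_eq_abs, sq_abs] at h1
  exact le_of_sq_le_sq h1 (norm_nonneg M)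

open scoped Matrix.Norms.L2Operator in
theorem IsSingularValue.one_le_mul_norm_inv {n : Type*} [Fintype n] [DecidableEq n] [Nonempty n]
    {M : Matrix n n ℝ} (hM : IsUnit M.det) {σ : ℝ} (h : IsSingularValue M σ) :
    1 ≤ σ * ‖M⁻¹‖ := by
  have hu : IsUnit (M * Mᴴ) := by
    rw [Matrix.isUnit_iff_isUnit_det, det_mul, det_conjTranspose]
    exact hM.mul hM.star
  obtain ⟨u, hu⟩ := hu
  have hinv : (↑u⁻¹ : Matrix n n ℝ) = (M⁻¹)ᴴ * M⁻¹ := by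
    rw [Matrix.coe_units_inv, hu, Matrix.mul_inv_rev, Matrix.conjTranspose_nonsing_inv]
  have hσ : σ ^ 2 ∈ spectrum ℝ (u : Matrix n n ℝ) := by rw [hu]; exact h.2
  have hσ0 : σ ^ 2 ≠ 0 := spectrum.ne_zero_of_mem_of_unit hσ
  have hmem : (σ ^ 2)⁻¹ ∈ spectrum ℝ (↑u⁻¹ : Matrix n n ℝ) := by
    simpa using (spectrum.inv_mem_iff (r := Units.mk0 _ hσ0) (a := u)).1 hσ
  have h1 := spectrum.norm_le_norm_of_mem hmem
  rw [hinv, Matrix.l2_opNorm_conjTranspose_mul_self, norm_inv, Real.norm_eq_abs,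
    abs_of_nonneg (sq_nonneg σ)] at h1
  have h2 : 0 < σ ^ 2 := by positivity
  rw [inv_le_iff_one_le_mul₀' h2] at h1
  have h3 : 0 ≤ σ * ‖M⁻¹‖ := mul_nonneg h.1 (norm_nonneg _)
  nlinarith

/-- The nilpotent shift matrix, with ones on the first subdiagonal. -/
def subdiagonalShift (N : ℕ) : Matrix (Fin N) (Fin N) ℝ :=
  fun i j => if (i : ℕ) = (j : ℕ) + 1 then 1 else 0

theorem thetaSchemeMatrix_eq (N : ℕ) (s₁ s₂ : ℝ) :
    thetaSchemeMatrix N s₁ s₂ = s₂ • 1 - s₁ • subdiagonalShift N := by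
  ext i j
  by_cases h : i = j
  · simp [thetaSchemeMatrix, subdiagonalShift, h]
  · simp [thetaSchemeMatrix, subdiagonalShift, h]
    split_ifs <;> simp

theorem isUnit_det_thetaSchemeMatrix (N : ℕ) (s₁ : ℝ) {s₂ : ℝ} (h : s₂ ≠ 0) :
    IsUnit (thetaSchemeMatrix N s₁ s₂).det := by
  rw [Matrix.det_of_isLowerTriangular]
  · simp [thetaSchemeMatrix, h]
  · intro i j hij
    have hlt : (i : ℕ) < j := hij
    have hne : (i : ℕ) ≠ j + 1 := by omega
    simp [thetaSchemeMatrix, Fin.ext_iff, hlt.ne, hne]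

theorem subdiagonalShift_conjTranspose_mul_self (N : ℕ) :
    (subdiagonalShift N)ᴴ * subdiagonalShift N =
      Matrix.diagonal fun i : Fin N => if (i : ℕ) + 1 < N then 1 else 0 := by
  ext i j
  simp only [Matrix.mul_apply, conjTranspose_apply, subdiagonalShift, diagonal_apply, star_trivial,
    mul_ite, mul_one, mul_zero, ← ite_and]
  by_cases hi : (i : ℕ) + 1 < N
  · rw [Finset.sum_eq_single (⟨i + 1, hi⟩ : Fin N)]
    · simp [hi, Fin.ext_iff]
    · intro k _ hk
      rw [if_neg]
      rintro ⟨-, h⟩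
      exact hk (Fin.ext (by simp; omega))
    · simp
  · rw [Finset.sum_eq_zero]
    · simp [hi]
    · intro k _
      rw [if_neg]
      have := k.2
      omega

open scoped Matrix.Norms.L2Operator in
theorem norm_subdiagonalShift_le_one (N : ℕ) : ‖subdiagonalShift N‖ ≤ 1 := by
  have h := Matrix.l2_opNorm_conjTranspose_mul_self (subdiagonalShift N)
  rw [subdiagonalShift_conjTranspose_mul_self, Matrix.l2_opNorm_diagonal] at h
  have h1 : ‖fun i : Fin N => if (i : ℕ) + 1 < N then (1 : ℝ) else 0‖ ≤ 1 := by
    refine (pi_norm_le_iff_of_nonneg zero_le_one).2 fun i => ?_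
    split_ifs <;> simp
  nlinarith [norm_nonneg (subdiagonalShift N)]

open scoped Matrix.Norms.L2Operator in
theorem norm_thetaSchemeMatrix_le {N : ℕ} [NeZero N] {s₁ s₂ : ℝ} (h₁ : 0 ≤ s₁) (h₂ : 0 ≤ s₂) :
    ‖thetaSchemeMatrix N s₁ s₂‖ ≤ s₂ + s₁ := by
  rw [thetaSchemeMatrix_eq]
  refine (norm_sub_le _ _).trans ?_
  rw [norm_smul, norm_smul, norm_one, Real.norm_of_nonneg h₁, Real.norm_of_nonneg h₂]
  nlinarith [norm_subdiagonalShift_le_one N]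

open scoped Matrix.Norms.L2Operator in
theorem sub_mul_norm_inv_thetaSchemeMatrix_le {N : ℕ} [NeZero N] {s₁ s₂ : ℝ} (h₁ : 0 ≤ s₁)
    (h₂ : 0 < s₂) : (s₂ - s₁) * ‖(thetaSchemeMatrix N s₁ s₂)⁻¹‖ ≤ 1 := by
  have h := Matrix.mul_nonsing_inv _ (isUnit_det_thetaSchemeMatrix N s₁ h₂.ne')
  set B := (thetaSchemeMatrix N s₁ s₂)⁻¹
  rw [thetaSchemeMatrix_eq, sub_mul, smul_mul_assoc, smul_mul_assoc, one_mul,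
    sub_eq_iff_eq_add] at h
  have hn : ‖s₂ • B‖ ≤ ‖(1 : Matrix (Fin N) (Fin N) ℝ)‖ + ‖s₁ • (subdiagonalShift N * B)‖ :=
    h ▸ norm_add_le _ _
  rw [norm_smul, norm_smul, norm_one, Real.norm_of_nonneg h₁, Real.norm_of_nonneg h₂.le] at hn
  have hSB : ‖subdiagonalShift N * B‖ ≤ ‖B‖ :=
    (norm_mul_le _ _).trans
      (mul_le_of_le_one_left (norm_nonneg B) (norm_subdiagonalShift_le_one N))
  linarith [mul_le_mul_of_nonneg_left hSB h₁]

/-- **Singular-value and condition-number bounds for the θ-scheme matrix.**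
If `a > 0`, `θ ∈ [0,1]`, `τ > 0` with `(1-θ)·a·τ < 1` and `Nt ≥ 2`, then every singular
value `σ` of the θ-scheme matrix satisfies `a·τ ≤ σ ≤ 2 + |2θ-1|·a·τ`; consequently its
spectral condition number (the ratio of the largest to the smallest singular value,
i.e. `‖A‖·‖A⁻¹‖`) is at most `(2 + |2θ-1|·a·τ)/(a·τ)`. -/
theorem stmt1 (a θ τ : ℝ) (ha : 0 < a) (hθ0 : 0 ≤ θ) (hθ1 : θ ≤ 1) (hτ : 0 < τ)
    (hstab : (1 - θ) * a * τ < 1) (Nt : ℕ) (hNt : 2 ≤ Nt)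
    (A : Matrix (Fin Nt) (Fin Nt) ℝ)
    (hA : A = thetaSchemeMatrix Nt (1 - (1 - θ) * a * τ) (1 + θ * a * τ)) :
    (∀ σ : ℝ, IsSingularValue A σ → a * τ ≤ σ ∧ σ ≤ 2 + |2 * θ - 1| * a * τ) ∧
    specNorm A * specNorm A⁻¹ ≤ (2 + |2 * θ - 1| * a * τ) / (a * τ) := by
  have : NeZero Nt := ⟨by omega⟩
  have haτ : 0 < a * τ := mul_pos ha hτ
  have h₁ : 0 ≤ 1 - (1 - θ) * a * τ := by linarith
  have h₂ : 0 < 1 + θ * a * τ := by positivity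
  have hub : specNorm A ≤ 2 + |2 * θ - 1| * a * τ := by
    rw [specNorm_eq_norm, hA]
    refine (norm_thetaSchemeMatrix_le h₁ h₂.le).trans ?_
    linarith [mul_le_mul_of_nonneg_right (le_abs_self (2 * θ - 1)) haτ.le]
  have hlb : a * τ * specNorm A⁻¹ ≤ 1 := by
    rw [specNorm_eq_norm, hA]
    convert sub_mul_norm_inv_thetaSchemeMatrix_le (N := Nt) h₁ h₂ using 2
    ring
  have hdet : IsUnit A.det := hA ▸ isUnit_det_thetaSchemeMatrix Nt _ h₂.ne'
  have hinv0 : 0 ≤ specNorm A⁻¹ := norm_nonneg _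
  refine ⟨fun σ hσ => ⟨?_, ?_⟩, ?_⟩
  · have h := hσ.one_le_mul_norm_inv hdet
    rw [← specNorm_eq_norm] at h
    by_contra! hlt
    have hpos : 0 < specNorm A⁻¹ := hinv0.lt_of_ne fun h0 => by simp [← h0] at h; linarith
    linarith [mul_lt_mul_of_pos_right hlt hpos]
  · exact (specNorm_eq_norm A ▸ hσ.le_norm).trans hub
  · rw [le_div_iff₀ haτ]
    calc specNorm A * specNorm A⁻¹ * (a * τ) = specNorm A * (a * τ * specNorm A⁻¹) := by ring
      _ ≤ specNorm A * 1 := mul_le_mul_of_nonneg_left hlb (norm_nonneg _)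
      _ ≤ _ := by simpa using hub
end

section
/- (Gershgorin-type theorem for singular values, Qi 1984.) Let A = (a_{ij}) be an n×n complex matrix. For each i = 1, …, n set r_i = Σ_{j≠i} |a_{ij}|, c_i = Σ_{j≠i} |a_{ji}|, and s_i = max(r_i, c_i). Then every singular value of A lies in the union over i of the real intervals [max(0, |a_{ii}| − s_i), |a_{ii}| + s_i]. -/
open Matrix

theorem Matrix.exists_mulVec_eq_smul_of_mem_spectrum {K n : Type*} [Field K] [Fintype n]
    [DecidableEq n] {M : Matrix n n K} {a : K} (h : a ∈ spectrum K M) :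
    ∃ v : n → K, v ≠ 0 ∧ M *ᵥ v = a • v := by
  rw [spectrum.mem_iff, Matrix.isUnit_iff_isUnit_det, isUnit_iff_ne_zero, not_not,
    ← Matrix.exists_mulVec_eq_zero_iff] at h
  obtain ⟨v, hv, h⟩ := h
  refine ⟨v, hv, ?_⟩
  rw [Matrix.sub_mulVec, sub_eq_zero, Algebra.algebraMap_eq_smul_one, Matrix.smul_mulVec,
    Matrix.one_mulVec] at h
  exact h.symm

open scoped ComplexOrder in
/-- The two singular vectors attached to a singular value. -/
theorem IsSingularValue.exists_singularVectors {𝕜 n : Type*} [RCLike 𝕜] [Fintype n]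
    [DecidableEq n] {A : Matrix n n 𝕜} {σ : ℝ} (hσ : IsSingularValue A σ) :
    ∃ x y : n → 𝕜, x ≠ 0 ∧ A *ᵥ y = (σ : 𝕜) • x ∧ Aᴴ *ᵥ x = (σ : 𝕜) • y := by
  obtain ⟨x, hx, h⟩ := Matrix.exists_mulVec_eq_smul_of_mem_spectrum hσ.2
  rcases eq_or_ne σ 0 with rfl | h0
  · refine ⟨x, 0, hx, by simp, ?_⟩
    simpa using (Matrix.self_mul_conjTranspose_mulVec_eq_zero A x).mp (by simpa using h)
  · have h0' : (σ : 𝕜) ≠ 0 := by exact_mod_cast h0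
    refine ⟨x, (σ : 𝕜)⁻¹ • (Aᴴ *ᵥ x), hx, ?_, ?_⟩
    · rw [Matrix.mulVec_smul, Matrix.mulVec_mulVec, h, smul_smul]
      congr 1
      rw [RCLike.algebraMap_eq_ofReal]
      push_cast
      field_simp
    · rw [smul_smul, mul_inv_cancel₀ h0', one_smul]

theorem Matrix.norm_mulVec_apply_sub_le {𝕜 n : Type*} [RCLike 𝕜] [Fintype n] [DecidableEq n]
    (B : Matrix n n 𝕜) {x : n → 𝕜} {m : ℝ} (hx : ∀ j, ‖x j‖ ≤ m) (i : n) :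
    ‖(B *ᵥ x) i - B i i * x i‖ ≤ (∑ j ∈ Finset.univ.erase i, ‖B i j‖) * m := by
  have h : (B *ᵥ x) i - B i i * x i = ∑ j ∈ Finset.univ.erase i, B i j * x j := by
    rw [Matrix.mulVec, dotProduct, ← Finset.add_sum_erase _ _ (Finset.mem_univ i),
      add_sub_cancel_left]
  rw [h, Finset.sum_mul]
  refine norm_sum_le_of_le _ fun j _ => ?_
  rw [norm_mul]
  exact mul_le_mul_of_nonneg_left (hx j) (norm_nonneg _)

/-- Gershgorin's estimate at a row `i` where `x` attains the largest modulus among all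
coordinates of `x` and `y`. -/
theorem Matrix.gershgorin_of_mulVec_eq_smul {𝕜 n : Type*} [RCLike 𝕜] [Fintype n] [DecidableEq n]
    {B C : Matrix n n 𝕜} {x y : n → 𝕜} {σ : ℝ} (hσ : 0 ≤ σ) (hB : B *ᵥ x = (σ : 𝕜) • y)
    (hC : C *ᵥ y = (σ : 𝕜) • x) {i : n} (hi : 0 < ‖x i‖)
    (hx : ∀ j, ‖x j‖ ≤ ‖x i‖) (hy : ∀ j, ‖y j‖ ≤ ‖x i‖) :
    ‖B i i‖ - ∑ j ∈ Finset.univ.erase i, ‖B i j‖ ≤ σ ∧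
      σ ≤ ‖C i i‖ + ∑ j ∈ Finset.univ.erase i, ‖C i j‖ := by
  have h₁ := B.norm_mulVec_apply_sub_le hx i
  have h₂ := C.norm_mulVec_apply_sub_le hy i
  rw [hB, norm_sub_rev] at h₁
  rw [hC] at h₂
  have h₃ := (norm_sub_norm_le _ _).trans h₁
  have h₄ := (norm_sub_norm_le _ _).trans h₂
  simp only [Pi.smul_apply, smul_eq_mul, norm_mul, RCLike.norm_ofReal, abs_of_nonneg hσ]
    at h₃ h₄
  have h₅ := mul_le_mul_of_nonneg_left (hy i) hσ
  have h₆ := mul_le_mul_of_nonneg_left (hy i) (norm_nonneg (C i i))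
  constructor <;> refine le_of_mul_le_mul_right ?_ hi <;> linarith

/-- **Gershgorin-type theorem for singular values (Qi, 1984).**
For an `n × n` complex matrix `A`, with `rᵢ = ∑_{j≠i} |a_{ij}|`, `cᵢ = ∑_{j≠i} |a_{ji}|`
and `sᵢ = max (rᵢ, cᵢ)`, every singular value of `A` lies in one of the real intervals
`[max 0 (|a_{ii}| - sᵢ), |a_{ii}| + sᵢ]`. -/
theorem stmt2 (n : ℕ) (A : Matrix (Fin n) (Fin n) ℂ) (σ : ℝ)
    (hσ : IsSingularValue A σ) :
    ∃ i : Fin n,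
      max 0 (‖A i i‖ - max (∑ j ∈ Finset.univ.erase i, ‖A i j‖)
                           (∑ j ∈ Finset.univ.erase i, ‖A j i‖)) ≤ σ ∧
      σ ≤ ‖A i i‖ + max (∑ j ∈ Finset.univ.erase i, ‖A i j‖)
                        (∑ j ∈ Finset.univ.erase i, ‖A j i‖) := by
  obtain ⟨x, y, hx, hy, hxy⟩ := hσ.exists_singularVectors
  obtain ⟨k, hk⟩ := Function.ne_iff.mp hx
  have : Nonempty (Fin n) := ⟨k⟩
  obtain ⟨i, hi⟩ := Finite.exists_max fun i => max ‖x i‖ ‖y i‖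
  have hpos : 0 < max ‖x i‖ ‖y i‖ :=
    ((norm_pos_iff.mpr hk).trans_le (le_max_left _ _)).trans_le (hi k)
  have hxi j := (le_max_left _ _).trans (hi j)
  have hyi j := (le_max_right _ _).trans (hi j)
  refine ⟨i, ?_⟩
  have hr := le_max_left (∑ j ∈ Finset.univ.erase i, ‖A i j‖)
    (∑ j ∈ Finset.univ.erase i, ‖A j i‖)
  have hc := le_max_right (∑ j ∈ Finset.univ.erase i, ‖A i j‖)
    (∑ j ∈ Finset.univ.erase i, ‖A j i‖)
  rw [max_le_iff, and_assoc]
  refine ⟨hσ.1, ?_⟩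
  rcases le_total ‖y i‖ ‖x i‖ with h | h
  · rw [max_eq_left h] at hpos hxi hyi
    have hg := Matrix.gershgorin_of_mulVec_eq_smul hσ.1 hxy hy hpos hxi hyi
    simp only [Matrix.conjTranspose_apply, norm_star] at hg
    constructor <;> linarith
  · rw [max_eq_right h] at hpos hxi hyi
    have hg := Matrix.gershgorin_of_mulVec_eq_smul hσ.1 hy hxy hpos hyi hxi
    simp only [Matrix.conjTranspose_apply, norm_star] at hg
    constructor <;> linarith
end

section
/- (Explicit scheme for the 1-D heat equation.) Let N_x ≥ 2, N_t ≥ 2, h = 1/N_x, τ > 0 and β = τ/h², and assume β ≤ 1/4 and τ ≤ 1/8. Let n = N_x − 1, set B = I_n + β·L_h, and let L be the square matrix of size N_t·n, organized as an N_t×N_t array of n×n blocks, with I_n on the block diagonal, −B on the first block subdiagonal, and 0 elsewhere. Then every singular value σ of L satisfies 8τ ≤ σ ≤ 3. -/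
open Matrix

/-- The `(Nx-1) × (Nx-1)` central-difference matrix `L_h`: symmetric tridiagonal with
`-2` on the main diagonal and `1` on the first sub- and super-diagonals. -/
def Lh (n : ℕ) : Matrix (Fin n) (Fin n) ℝ :=
  fun i j => if i = j then -2 else if (i : ℕ) = (j : ℕ) + 1 ∨ (j : ℕ) = (i : ℕ) + 1 then 1 else 0

/-- The `N·n × N·n` block matrix, organized as an `N × N` array of `n × n` blocks, with
`D` on the block diagonal, `S` on the first block subdiagonal, and `0` elsewhere. -/
def blockBidiag {N n : ℕ} (D S : Matrix (Fin n) (Fin n) ℝ) :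
    Matrix (Fin N × Fin n) (Fin N × Fin n) ℝ :=
  fun p q =>
    if p.1 = q.1 then D p.2 q.2
    else if (p.1 : ℕ) = (q.1 : ℕ) + 1 then S p.2 q.2 else 0

/-- **Schur test** for a nonnegative matrix and a single positive weight vector. -/
theorem sum_mulVec_sq_le_of_weight {m : Type*} [Fintype m] (A : Matrix m m ℝ) (s : m → ℝ) (μ : ℝ)
    (hA : ∀ i j, 0 ≤ A i j) (hs : ∀ i, 0 < s i) (hμ : 0 ≤ μ)
    (hrow : ∀ i, ∑ j, A i j * s j ≤ μ * s i) (hcol : ∀ j, ∑ i, A i j * s i ≤ μ * s j)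
    (v : m → ℝ) : ∑ i, (A *ᵥ v) i ^ 2 ≤ μ ^ 2 * ∑ i, v i ^ 2 := by
  have cauchy : ∀ i, (A *ᵥ v) i ^ 2 ≤ (∑ j, A i j * s j) * ∑ j, A i j * (v j ^ 2 / s j) := by
    intro i
    refine Finset.sum_sq_le_sum_mul_sum_of_sq_le_mul _
      (fun j _ => mul_nonneg (hA i j) (hs j).le)
      (fun j _ => mul_nonneg (hA i j) (div_nonneg (sq_nonneg _) (hs j).le)) (fun j _ => le_of_eq ?_)
    have := (hs j).ne'
    field_simp
  calc ∑ i, (A *ᵥ v) i ^ 2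
      ≤ ∑ i, μ * s i * ∑ j, A i j * (v j ^ 2 / s j) := by
        refine Finset.sum_le_sum fun i _ => (cauchy i).trans ?_
        exact mul_le_mul_of_nonneg_right (hrow i) (Finset.sum_nonneg fun j _ =>
          mul_nonneg (hA i j) (div_nonneg (sq_nonneg _) (hs j).le))
    _ = ∑ j, μ * (v j ^ 2 / s j) * ∑ i, A i j * s i := by
        simp only [Finset.mul_sum]
        rw [Finset.sum_comm]
        exact Finset.sum_congr rfl fun j _ => Finset.sum_congr rfl fun i _ => by ring
    _ ≤ ∑ j, μ * (v j ^ 2 / s j) * (μ * s j) :=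
        Finset.sum_le_sum fun j _ => mul_le_mul_of_nonneg_left (hcol j)
          (mul_nonneg hμ (div_nonneg (sq_nonneg _) (hs j).le))
    _ = μ ^ 2 * ∑ i, v i ^ 2 := by
        rw [Finset.mul_sum]
        refine Finset.sum_congr rfl fun j _ => ?_
        have := (hs j).ne'
        field_simp

/-- Singular values of `1 - A` lie in `[1 - μ, 1 + μ]` if `Aᵀ` is bounded by `μ` in the
Euclidean norm. -/
theorem IsSingularValue.bounds_one_sub {m : Type*} [Fintype m] [DecidableEq m]
    {A : Matrix m m ℝ} {μ σ : ℝ} (hμ : 0 ≤ μ)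
    (hA : ∀ v : m → ℝ, ∑ i, (Aᵀ *ᵥ v) i ^ 2 ≤ μ ^ 2 * ∑ i, v i ^ 2)
    (hσ : IsSingularValue (1 - A) σ) : 1 - μ ≤ σ ∧ σ ≤ 1 + μ := by
  obtain ⟨hσ0, hspec⟩ := hσ
  rw [← Matrix.spectrum_toLin', ← Module.End.hasEigenvalue_iff_mem_spectrum] at hspec
  obtain ⟨v, hv⟩ := hspec.exists_hasEigenvector
  have heig : ((1 - A) * (1 - A)ᵀ) *ᵥ v = σ ^ 2 • v := by
    rw [← conjTranspose_eq_transpose_of_trivial, ← toLin'_apply]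
    exact hv.apply_eq_smul
  let x : EuclideanSpace ℝ m := WithLp.toLp 2 v
  let w : EuclideanSpace ℝ m := WithLp.toLp 2 (Aᵀ *ᵥ v)
  have hx : 0 < ‖x‖ := norm_pos_iff.2 fun h => hv.2 (by simpa [x] using h)
  have hw : ‖w‖ ≤ μ * ‖x‖ := by
    refine le_of_sq_le_sq ?_ (by positivity)
    rw [mul_pow, EuclideanSpace.real_norm_sq_eq, EuclideanSpace.real_norm_sq_eq]
    exact hA v
  have hxw : ‖x - w‖ = σ * ‖x‖ := by
    refine (sq_eq_sq₀ (norm_nonneg _) (by positivity)).1 ?_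
    rw [mul_pow, EuclideanSpace.real_norm_sq_eq, EuclideanSpace.real_norm_sq_eq]
    have h1 : ∑ i, (x - w) i ^ 2 = v ⬝ᵥ (((1 - A) * (1 - A)ᵀ) *ᵥ v) := by
      rw [← mulVec_mulVec, dotProduct_mulVec, ← mulVec_transpose, transpose_sub, transpose_one,
        sub_mulVec, one_mulVec]
      simp [dotProduct, x, w, sq]
    rw [h1, heig, dotProduct_smul, smul_eq_mul]
    simp [dotProduct, x, sq]
  have h1 := norm_sub_le x w
  have h2 := norm_sub_norm_le x w
  constructor <;> refine le_of_mul_le_mul_right ?_ hx <;> linarith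

/-- Tridiagonal action of `Lh n` on a sequence vanishing just past the right end. -/
theorem sum_Lh_mul (n : ℕ) (f : ℕ → ℝ) (hf : f n = 0) (i : Fin n) :
    ∑ j, Lh n i j * f j = (if (i : ℕ) = 0 then 0 else f (i - 1)) - 2 * f i + f (i + 1) := by
  obtain ⟨i, hi⟩ := i
  have hsplit : ∀ j : Fin n, Lh n ⟨i, hi⟩ j * f j =
      (if i = (j : ℕ) + 1 then f j else 0) + (if i = (j : ℕ) then -2 * f j else 0)
        + (if i + 1 = (j : ℕ) then f j else 0) := by
    intro j
    simp only [Lh, Fin.ext_iff]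
    split_ifs <;> first | omega | simp
  simp only [hsplit]
  rw [Fin.sum_univ_eq_sum_range (fun j => (if i = j + 1 then f j else 0)
      + (if i = j then -2 * f j else 0) + (if i + 1 = j then f j else 0)) n,
    Finset.sum_add_distrib, Finset.sum_add_distrib, Finset.sum_ite_eq, Finset.sum_ite_eq]
  have hlast : (if i + 1 ∈ Finset.range n then f (i + 1) else 0) = f (i + 1) := by
    by_cases h : i + 1 < n
    · simp [h]
    · have : i + 1 = n := by omega
      simp [this, hf]
  have hfirst : ∑ j ∈ Finset.range n, (if i = j + 1 then f j else 0)
      = if i = 0 then 0 else f (i - 1) := by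
    rcases i with _ | k
    · simp
    · simp only [add_left_inj, Finset.sum_ite_eq, Finset.mem_range]
      simp [show k < n by omega]
  rw [hlast, hfirst]
  simp only [Finset.mem_range, hi, if_true]
  ring

theorem Lh_comm (n : ℕ) (i j : Fin n) : Lh n i j = Lh n j i := by
  simp only [Lh, eq_comm, or_comm]

/-- The discrete Laplacian of the parabola `(i + 1) * (n - i)` is `-2`. -/
theorem sum_Lh_mul_parabola (n : ℕ) (i : Fin n) :
    ∑ j : Fin n, Lh n i j * (((j : ℕ) + 1 : ℝ) * (n - (j : ℕ))) = -2 := by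
  rw [sum_Lh_mul n (fun k => ((k : ℝ) + 1) * (n - k)) (by simp) i]
  obtain ⟨_ | k, hi⟩ := i
  · simp
    ring
  · simp
    ring

theorem Fintype.sum_ite_le_of_subsingleton {ι : Type*} [Fintype ι] (P : ι → Prop)
    [DecidablePred P] (hP : ∀ a b, P a → P b → a = b) {c : ℝ} (hc : 0 ≤ c) :
    ∑ a, (if P a then c else 0) ≤ c := by
  by_cases h : ∃ a, P a
  · obtain ⟨a, ha⟩ := h
    rw [Finset.sum_eq_single a (fun b _ hb => if_neg fun hPb => hb (hP b a hPb ha)) (by simp),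
      if_pos ha]
  · push Not at h
    simpa [h] using hc

/-- If a symmetric nonnegative matrix `B` contracts a positive weight by the factor `μ`, then the
singular values of the block bidiagonal matrix with blocks `1` and `-B` lie in
`[1 - μ, 1 + μ]`. -/
theorem blockBidiag_singularValue_bounds {N n : ℕ} (B : Matrix (Fin n) (Fin n) ℝ)
    (s : Fin n → ℝ) {μ σ : ℝ} (hB : ∀ i j, 0 ≤ B i j) (hsymm : ∀ i j, B i j = B j i)
    (hs : ∀ i, 0 < s i) (hμ : 0 ≤ μ) (hBs : ∀ i, ∑ j, B i j * s j ≤ μ * s i)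
    (hσ : IsSingularValue (blockBidiag (N := N) 1 (-B)) σ) : 1 - μ ≤ σ ∧ σ ≤ 1 + μ := by
  obtain ⟨A, hA⟩ : ∃ A : Matrix (Fin N × Fin n) (Fin N × Fin n) ℝ,
      ∀ p q, A p q = if (p.1 : ℕ) = q.1 + 1 then B p.2 q.2 else 0 := ⟨_, fun _ _ => rfl⟩
  have hL : blockBidiag (N := N) 1 (-B) = 1 - A := by
    ext ⟨a, i⟩ ⟨b, j⟩
    rw [Matrix.sub_apply, hA]
    by_cases hab : a = b
    · subst hab
      simp [blockBidiag, Matrix.one_apply]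
    · simp only [blockBidiag, Matrix.one_apply, Matrix.neg_apply, Prod.mk.injEq, hab, false_and,
        if_false]
      split_ifs <;> simp
  have hsum : ∀ (P : Fin N → Prop) [DecidablePred P], (∀ a b, P a → P b → a = b) → ∀ i : Fin n,
      ∑ q : Fin N × Fin n, (if P q.1 then B i q.2 else 0) * s q.2 ≤ μ * s i := by
    intro P _ hP i
    rw [Fintype.sum_prod_type]
    have hrw : ∀ a, ∑ j, (if P a then B i j else 0) * s j
        = if P a then ∑ j, B i j * s j else 0 := by
      intro a
      split_ifs <;> simp
    simp only [hrw]
    exact (Fintype.sum_ite_le_of_subsingleton P hP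
      (Finset.sum_nonneg fun j _ => mul_nonneg (hB i j) (hs j).le)).trans (hBs i)
  rw [hL] at hσ
  refine hσ.bounds_one_sub hμ (sum_mulVec_sq_le_of_weight Aᵀ (fun p => s p.2) μ ?_
    (fun p => hs p.2) hμ ?_ ?_)
  · intro p q
    simp only [Matrix.transpose_apply, hA]
    split_ifs
    exacts [hB _ _, le_rfl]
  · intro p
    simp only [Matrix.transpose_apply, hA, hsymm _ p.2]
    exact hsum (fun a => (a : ℕ) = p.1 + 1) (fun a b ha hb => Fin.ext (ha.trans hb.symm)) p.2
  · intro p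
    simp only [Matrix.transpose_apply, hA]
    exact hsum (fun a => (p.1 : ℕ) = a + 1) (fun a b ha hb => Fin.ext (by omega)) p.2

/-- **Singular-value bounds for the explicit (forward Euler) scheme for the 1-D heat
equation.** With `h = 1/Nx`, `β = τ/h² ≤ 1/4`, `τ ≤ 1/8`, `B = I + β·L_h` and `L` the
block bidiagonal space-time matrix with `I` on the block diagonal and `-B` on the first
block subdiagonal, every singular value `σ` of `L` satisfies `8τ ≤ σ ≤ 3`. -/
theorem stmt7 (Nx Nt : ℕ) (hNx : 2 ≤ Nx) (hNt : 2 ≤ Nt) (h τ β : ℝ)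
    (hh : h = 1 / Nx) (hτ : 0 < τ) (hβ : β = τ / h ^ 2)
    (hCFL : β ≤ 1 / 4) (hτ8 : τ ≤ 1 / 8)
    (B : Matrix (Fin (Nx - 1)) (Fin (Nx - 1)) ℝ) (hB : B = 1 + β • Lh (Nx - 1))
    (L : Matrix (Fin Nt × Fin (Nx - 1)) (Fin Nt × Fin (Nx - 1)) ℝ)
    (hL : L = blockBidiag 1 (-B)) :
    ∀ σ : ℝ, IsSingularValue L σ → 8 * τ ≤ σ ∧ σ ≤ 3 := by
  intro σ hσ
  subst hB hL
  generalize hn : Nx - 1 = n at hσ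
  obtain rfl : Nx = n + 1 := by omega
  obtain ⟨B, hB⟩ : ∃ B, B = 1 + β • Lh n := ⟨_, rfl⟩
  rw [← hB] at hσ
  have hβτ : β = τ * ((n : ℝ) + 1) ^ 2 := by
    rw [hβ, hh]
    push_cast
    field_simp
  have hβ0 : 0 ≤ β := by rw [hβτ]; positivity
  have hbounds := blockBidiag_singularValue_bounds B
    (fun i => ((i : ℕ) + 1 : ℝ) * (n - (i : ℕ))) (μ := 1 - 8 * τ) ?_ ?_ ?_ (by linarith) ?_ hσ
  · constructor <;> linarith [hbounds.1, hbounds.2]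
  · intro i j
    simp only [hB, Matrix.add_apply, Matrix.smul_apply, Matrix.one_apply, Lh, smul_eq_mul]
    split_ifs <;> linarith
  · intro i j
    simp only [hB, Matrix.add_apply, Matrix.smul_apply, Matrix.one_apply, Lh_comm n i j,
      eq_comm (a := i)]
  · intro i
    have : ((i : ℕ) : ℝ) < n := by exact_mod_cast i.2
    exact mul_pos (by positivity) (by linarith)
  · intro i
    have hrow : ∑ j : Fin n, B i j * (((j : ℕ) + 1 : ℝ) * (n - (j : ℕ)))
        = ((i : ℕ) + 1 : ℝ) * (n - (i : ℕ)) + β * -2 := by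
      rw [← sum_Lh_mul_parabola n i, Finset.mul_sum]
      simp [hB, Matrix.one_apply, add_mul, Finset.sum_add_distrib, mul_assoc]
    rw [hrow, hβτ]
    nlinarith [mul_nonneg hτ.le (sq_nonneg (((i : ℕ) + 1 : ℝ) - (n - (i : ℕ))))]
end

section
/- (Norm bound for the d-dimensional upwind amplification matrix.) Let d ≥ 1, N_x ≥ 1, and let λ be a real number with 0 ≤ λ and d·λ ≤ 1. Let B be the real matrix indexed by multi-indices j ∈ {1, …, N_x}^d whose (j, j′) entry equals 1 − dλ if j′ = j, equals λ if j′ agrees with j in all coordinates except exactly one coordinate k, in which j′_k = j_k − 1, and equals 0 otherwise. Then ‖B‖ ≤ 1, where ‖·‖ is the spectral norm. -/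
open Matrix

/-- The time-stepping matrix of the `d`-dimensional first-order upwind scheme, indexed
by multi-indices `j ∈ {1,…,Nx}^d`: the `(j,j')` entry is `1 - d·λ` if `j' = j`, is `λ`
if `j'` agrees with `j` in all coordinates except exactly one coordinate `k`, in which
`j'_k = j_k - 1`, and is `0` otherwise. -/
noncomputable def upwindMatrix (d Nx : ℕ) (lam : ℝ) :
    Matrix (Fin d → Fin Nx) (Fin d → Fin Nx) ℝ :=
  fun j j' =>
    if j = j' then 1 - d * lam
    else if ∃ k : Fin d, (j' k : ℕ) + 1 = (j k : ℕ) ∧ ∀ l, l ≠ k → j l = j' l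
    then lam else 0

/-- Schur test for the spectral norm: a nonnegative matrix whose row and column sums are at
most one is a contraction. -/
theorem specNorm_le_one_of_sum_le_one {m n : Type*} [Fintype m] [Fintype n] [DecidableEq n]
    (M : Matrix m n ℝ) (hM : ∀ i j, 0 ≤ M i j) (hrow : ∀ i, ∑ j, M i j ≤ 1)
    (hcol : ∀ j, ∑ i, M i j ≤ 1) : specNorm M ≤ 1 := by
  refine ContinuousLinearMap.opNorm_le_bound _ zero_le_one fun x => ?_
  rw [one_mul, LinearMap.coe_toContinuousLinearMap', EuclideanSpace.norm_eq,
    EuclideanSpace.norm_eq]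
  refine Real.sqrt_le_sqrt ?_
  simp only [Real.norm_eq_abs, sq_abs]
  have hentry : ∀ i, (Matrix.toEuclideanLin M x) i ^ 2 ≤ ∑ j, M i j * x j ^ 2 := by
    intro i
    have happ : (Matrix.toEuclideanLin M x) i = ∑ j, M i j * x j := rfl
    rw [happ]
    have hcs : (∑ j, M i j * x j) ^ 2 ≤ (∑ j, M i j) * ∑ j, M i j * x j ^ 2 :=
      Finset.sum_sq_le_sum_mul_sum_of_sq_le_mul _ (fun j _ => hM i j)
        (fun j _ => mul_nonneg (hM i j) (sq_nonneg _)) (fun j _ => le_of_eq (by ring))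
    exact hcs.trans (mul_le_of_le_one_left
      (Finset.sum_nonneg fun j _ => mul_nonneg (hM i j) (sq_nonneg _)) (hrow i))
  calc ∑ i, (Matrix.toEuclideanLin M x) i ^ 2
      ≤ ∑ i, ∑ j, M i j * x j ^ 2 := Finset.sum_le_sum fun i _ => hentry i
    _ = ∑ j, (∑ i, M i j) * x j ^ 2 := by
      rw [Finset.sum_comm]
      simp only [Finset.sum_mul]
    _ ≤ ∑ j, x j ^ 2 := Finset.sum_le_sum fun j _ =>
      mul_le_of_le_one_left (sq_nonneg _) (hcol j)

theorem sum_ite_le_of_unique {α : Type*} [Fintype α] (p : α → Prop) [DecidablePred p]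
    (hp : ∀ a b, p a → p b → a = b) {c : ℝ} (hc : 0 ≤ c) :
    ∑ a, (if p a then c else 0) ≤ c := by
  rw [← Finset.sum_filter, Finset.sum_const, nsmul_eq_mul]
  refine mul_le_of_le_one_left hc ?_
  have hcard : (Finset.univ.filter p).card ≤ 1 :=
    Finset.card_le_one.2 fun a ha b hb =>
      hp a b (Finset.mem_filter.1 ha).2 (Finset.mem_filter.1 hb).2
  exact_mod_cast hcard

/-- `j'` is the upwind neighbour of `j` in direction `k`. -/
def IsUpwindNeighbor {d Nx : ℕ} (k : Fin d) (j j' : Fin d → Fin Nx) : Prop :=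
  (j' k : ℕ) + 1 = (j k : ℕ) ∧ ∀ l, l ≠ k → j l = j' l

theorem IsUpwindNeighbor.right_unique {d Nx : ℕ} {k : Fin d} {j a b : Fin d → Fin Nx}
    (ha : IsUpwindNeighbor k j a) (hb : IsUpwindNeighbor k j b) : a = b := by
  funext l
  rcases eq_or_ne l k with rfl | hl
  · exact Fin.ext (by have := ha.1; have := hb.1; omega)
  · rw [← ha.2 l hl, hb.2 l hl]

theorem IsUpwindNeighbor.left_unique {d Nx : ℕ} {k : Fin d} {j a b : Fin d → Fin Nx}
    (ha : IsUpwindNeighbor k a j) (hb : IsUpwindNeighbor k b j) : a = b := by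
  funext l
  rcases eq_or_ne l k with rfl | hl
  · exact Fin.ext (by have := ha.1; have := hb.1; omega)
  · rw [ha.2 l hl, hb.2 l hl]

theorem upwindMatrix_nonneg {d Nx : ℕ} {lam : ℝ} (hlam0 : 0 ≤ lam)
    (hlam1 : (d : ℝ) * lam ≤ 1) (j j' : Fin d → Fin Nx) : 0 ≤ upwindMatrix d Nx lam j j' := by
  unfold upwindMatrix
  split_ifs
  exacts [sub_nonneg.2 hlam1, hlam0, le_rfl]

open Classical in
theorem upwindMatrix_le {d Nx : ℕ} {lam : ℝ} (hlam0 : 0 ≤ lam) (j j' : Fin d → Fin Nx) :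
    upwindMatrix d Nx lam j j' ≤ (if j = j' then 1 - d * lam else 0) +
      ∑ k, if IsUpwindNeighbor k j j' then lam else 0 := by
  have hnonneg : ∀ k ∈ Finset.univ, 0 ≤ if IsUpwindNeighbor k j j' then lam else 0 := by
    intro k _
    split_ifs
    exacts [hlam0, le_rfl]
  have hsum := Finset.sum_nonneg hnonneg
  unfold upwindMatrix
  split_ifs with hjj hk
  · exact le_add_of_nonneg_right hsum
  · obtain ⟨k, hk⟩ := hk
    have hle := Finset.single_le_sum hnonneg (Finset.mem_univ k)
    rw [if_pos (show IsUpwindNeighbor k j j' from hk)] at hle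
    rwa [zero_add]
  · rwa [zero_add]

theorem sum_upwindMatrix_row_le_one {d Nx : ℕ} {lam : ℝ} (hlam0 : 0 ≤ lam)
    (j : Fin d → Fin Nx) : ∑ j', upwindMatrix d Nx lam j j' ≤ 1 := by
  classical
  refine (Finset.sum_le_sum fun j' _ => upwindMatrix_le hlam0 j j').trans ?_
  rw [Finset.sum_add_distrib, Finset.sum_comm, Finset.sum_ite_eq, if_pos (Finset.mem_univ _)]
  have hneighbors := Finset.sum_le_card_nsmul Finset.univ
    (fun k => ∑ j', if IsUpwindNeighbor k j j' then lam else 0) lam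
    fun k _ => sum_ite_le_of_unique _ (fun _ _ => IsUpwindNeighbor.right_unique) hlam0
  rw [Finset.card_univ, Fintype.card_fin, nsmul_eq_mul] at hneighbors
  linarith

theorem sum_upwindMatrix_col_le_one {d Nx : ℕ} {lam : ℝ} (hlam0 : 0 ≤ lam)
    (j' : Fin d → Fin Nx) : ∑ j, upwindMatrix d Nx lam j j' ≤ 1 := by
  classical
  refine (Finset.sum_le_sum fun j _ => upwindMatrix_le hlam0 j j').trans ?_
  rw [Finset.sum_add_distrib, Finset.sum_comm, Finset.sum_ite_eq', if_pos (Finset.mem_univ _)]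
  have hneighbors := Finset.sum_le_card_nsmul Finset.univ
    (fun k => ∑ j, if IsUpwindNeighbor k j j' then lam else 0) lam
    fun k _ => sum_ite_le_of_unique _ (fun _ _ => IsUpwindNeighbor.left_unique) hlam0
  rw [Finset.card_univ, Fintype.card_fin, nsmul_eq_mul] at hneighbors
  linarith

/-- **Norm bound for the `d`-dimensional upwind amplification matrix.**
If `0 ≤ λ` and `d·λ ≤ 1` then the spectral norm of the upwind time-stepping matrix is
at most `1`. -/
theorem stmt10 (d Nx : ℕ) (hd : 1 ≤ d) (hNx : 1 ≤ Nx) (lam : ℝ)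
    (hlam0 : 0 ≤ lam) (hlam1 : (d : ℝ) * lam ≤ 1) :
    specNorm (upwindMatrix d Nx lam) ≤ 1 := by
  exact specNorm_le_one_of_sum_le_one _ (upwindMatrix_nonneg hlam0 hlam1)
    (sum_upwindMatrix_row_le_one hlam0) (sum_upwindMatrix_col_le_one hlam0)
end

section
/- Let ι and h be real numbers with 1/4 ≤ ι ≤ 1/2 and 0 < h ≤ 1, and set τ = ι·h² and β = ι·h. Then (1−τ)² + β² ≤ 1 and 1 − √((1−τ)² + β²) ≥ h²/8. -/
/-- **Scalar inequality for the ε = 0 IMEX lower bound.** For `1/4 ≤ ι ≤ 1/2`,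
`0 < h ≤ 1`, `τ = ι·h²` and `β = ι·h`, one has `(1-τ)² + β² ≤ 1` and
`1 - √((1-τ)² + β²) ≥ h²/8`. -/
theorem stmt14 (ι h τ β : ℝ) (hι1 : 1 / 4 ≤ ι) (hι2 : ι ≤ 1 / 2)
    (hh0 : 0 < h) (hh1 : h ≤ 1) (hτ : τ = ι * h ^ 2) (hβ : β = ι * h) :
    (1 - τ) ^ 2 + β ^ 2 ≤ 1 ∧ h ^ 2 / 8 ≤ 1 - Real.sqrt ((1 - τ) ^ 2 + β ^ 2) := by
  have hx0 : 0 < h ^ 2 := by positivity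
  have hx1 : h ^ 2 ≤ 1 := pow_le_one₀ hh0.le hh1
  have hsq : ι ^ 2 * (1 + h ^ 2) ≤ ι := by
    calc ι ^ 2 * (1 + h ^ 2) ≤ ι ^ 2 * 2 := by gcongr; linarith
      _ ≤ ι := by nlinarith
  have key : (1 - τ) ^ 2 + β ^ 2 ≤ 1 - h ^ 2 / 4 := by
    have := mul_nonneg hx0.le (show 0 ≤ 2 * ι - ι ^ 2 * (1 + h ^ 2) - 1 / 4 by linarith)
    subst hτ hβ
    linarith
  refine ⟨by linarith, ?_⟩
  have hsqrt : Real.sqrt ((1 - τ) ^ 2 + β ^ 2) ≤ 1 - h ^ 2 / 8 := by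
    refine Real.sqrt_le_iff.mpr ⟨by linarith, ?_⟩
    linarith [sq_nonneg (h ^ 2)]
  linarith
end

section
/- Let L₁₁ be a real n×n matrix and L₂₁ a real m×n matrix, and let L be the (n+m)×(n+m) block lower-triangular matrix L = [[L₁₁, 0],[L₂₁, I_m]]. Then the smallest singular value of L satisfies σ_min(L) ≥ min(σ_min(L₁₁), 1) / (1 + ‖L₂₁‖), where ‖·‖ is the spectral norm. -/
open Matrix

lemma norm_toLp_eq_sqrt_dotProduct {n : Type*} [Fintype n] (v : n → ℝ) :
    ‖WithLp.toLp 2 v‖ = √(v ⬝ᵥ v) := by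
  simp [EuclideanSpace.norm_eq, dotProduct, sq]

lemma real_dotProduct_self_nonneg {n : Type*} [Fintype n] (v : n → ℝ) : 0 ≤ v ⬝ᵥ v :=
  Finset.sum_nonneg fun i _ => mul_self_nonneg (v i)

lemma abs_dotProduct_mulVec_le_specNorm {m n : Type*} [Fintype m] [Fintype n] [DecidableEq n]
    (M : Matrix m n ℝ) (y : m → ℝ) (u : n → ℝ) :
    |y ⬝ᵥ M *ᵥ u| ≤ specNorm M * √(u ⬝ᵥ u) * √(y ⬝ᵥ y) := by
  have hop := (Matrix.toEuclideanLin M).toContinuousLinearMap.le_opNorm (WithLp.toLp 2 u)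
  have hinner := abs_real_inner_le_norm (WithLp.toLp 2 (M *ᵥ u)) (WithLp.toLp 2 y)
  rw [EuclideanSpace.inner_toLp_toLp] at hinner
  change ‖WithLp.toLp 2 (M *ᵥ u)‖ ≤ specNorm M * _ at hop
  rw [norm_toLp_eq_sqrt_dotProduct u] at hop
  rw [norm_toLp_eq_sqrt_dotProduct y] at hinner
  exact hinner.trans (mul_le_mul_of_nonneg_right hop (Real.sqrt_nonneg _))

lemma specNorm_nonneg {𝕜 : Type*} [RCLike 𝕜] {m n : Type*} [Fintype m] [Fintype n]
    [DecidableEq n] (M : Matrix m n 𝕜) : 0 ≤ specNorm M :=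
  norm_nonneg _

lemma dotProduct_mul_conjTranspose_mulVec {n : Type*} [Fintype n] (M : Matrix n n ℝ)
    (x : n → ℝ) : x ⬝ᵥ (M * Mᴴ) *ᵥ x = (Mᵀ *ᵥ x) ⬝ᵥ (Mᵀ *ᵥ x) := by
  rw [conjTranspose_eq_transpose_of_trivial, ← mulVec_mulVec, dotProduct_mulVec, ← mulVec_transpose]

/-- An eigenvector of `M * Mᴴ` for the singular value `σ`. -/
lemma IsSingularValue.exists_dotProduct_eq {n : Type*} [Fintype n] [DecidableEq n]
    {M : Matrix n n ℝ} {σ : ℝ} (h : IsSingularValue M σ) :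
    ∃ w : n → ℝ, 0 < w ⬝ᵥ w ∧ (Mᵀ *ᵥ w) ⬝ᵥ (Mᵀ *ᵥ w) = σ ^ 2 * (w ⬝ᵥ w) := by
  have hs := h.2
  rw [← Matrix.spectrum_toLin', ← Module.End.hasEigenvalue_iff_mem_spectrum] at hs
  obtain ⟨w, hw⟩ := hs.exists_hasEigenvector
  have hw' := hw.apply_eq_smul
  rw [Matrix.toLin'_apply] at hw'
  refine ⟨w, ?_, ?_⟩
  · exact lt_of_le_of_ne (real_dotProduct_self_nonneg w)
      fun h0 => hw.2 (dotProduct_self_eq_zero.1 h0.symm)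
  · rw [← dotProduct_mul_conjTranspose_mulVec, hw', dotProduct_smul]
    simp

/-- A nonnegative lower bound for the singular values bounds `‖Mᵀ x‖` from below. -/
lemma sq_mul_dotProduct_le_of_le_singularValue {n : Type*} [Fintype n] [DecidableEq n]
    {M : Matrix n n ℝ} {s : ℝ} (hs : 0 ≤ s) (hmin : ∀ σ, IsSingularValue M σ → s ≤ σ)
    (x : n → ℝ) : s ^ 2 * (x ⬝ᵥ x) ≤ (Mᵀ *ᵥ x) ⬝ᵥ (Mᵀ *ᵥ x) := by
  have hA : (M * Mᴴ).PosSemidef := posSemidef_self_mul_conjTranspose M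
  have hB : (M * Mᴴ - algebraMap ℝ _ (s ^ 2)).PosSemidef := by
    rw [posSemidef_iff_isHermitian_and_spectrum_nonneg]
    refine ⟨hA.isHermitian.sub ?_, fun μ hμ => ?_⟩
    · rw [Algebra.algebraMap_eq_smul_one]
      exact isHermitian_one.smul (IsSelfAdjoint.all _)
    · have hμ' : μ + s ^ 2 ∈ spectrum ℝ (M * Mᴴ) := by
        rw [spectrum.mem_iff] at hμ ⊢
        convert hμ using 2
        rw [map_add]
        abel
      have h0 : 0 ≤ μ + s ^ 2 :=
        (posSemidef_iff_isHermitian_and_spectrum_nonneg.1 hA).2 hμ'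
      have hle := hmin (√(μ + s ^ 2)) ⟨Real.sqrt_nonneg _, by
        rw [Real.sq_sqrt h0]; exact hμ'⟩
      have hsq := pow_le_pow_left₀ hs hle 2
      rw [Real.sq_sqrt h0] at hsq
      change 0 ≤ μ
      linarith
  have hx := hB.dotProduct_mulVec_nonneg x
  rw [star_trivial, sub_mulVec, dotProduct_sub, dotProduct_mul_conjTranspose_mulVec,
    Algebra.algebraMap_eq_smul_one, smul_mulVec, one_mulVec, dotProduct_smul, smul_eq_mul] at hx
  linarith

/-- **Smallest singular value of a block lower-triangular matrix with identity block.**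
For `L = [[L₁₁, 0], [L₂₁, I]]`, if `σm` is the smallest singular value of `L₁₁`, then
every singular value of `L` (in particular the smallest) is at least
`min (σm, 1) / (1 + ‖L₂₁‖)`, where `‖·‖` is the spectral norm. -/
theorem stmt15 (n m : ℕ) (L11 : Matrix (Fin n) (Fin n) ℝ)
    (L21 : Matrix (Fin m) (Fin n) ℝ)
    (L : Matrix (Fin n ⊕ Fin m) (Fin n ⊕ Fin m) ℝ)
    (hL : L = Matrix.fromBlocks L11 0 L21 1)
    (σm : ℝ) (hσm : IsSingularValue L11 σm)
    (hmin : ∀ σ : ℝ, IsSingularValue L11 σ → σm ≤ σ) :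
    ∀ σ : ℝ, IsSingularValue L σ → min σm 1 / (1 + specNorm L21) ≤ σ := by
  intro σ hσ
  obtain ⟨w, hw, hLw⟩ := hσ.exists_dotProduct_eq
  obtain ⟨x, y, rfl⟩ : ∃ x y, w = Sum.elim x y :=
    ⟨w ∘ Sum.inl, w ∘ Sum.inr, (Sum.elim_comp_inl_inr w).symm⟩
  subst hL
  have hs := hσm.1
  have hσ0 := hσ.1
  have hx := sq_mul_dotProduct_le_of_le_singularValue hs hmin x
  have hbound := abs_dotProduct_mulVec_le_specNorm L21 y
  have hl := specNorm_nonneg L21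
  set l := specNorm L21
  set v := L11ᵀ *ᵥ x
  set p := L21ᵀ *ᵥ y with hp
  have hyp (u : Fin n → ℝ) : y ⬝ᵥ L21 *ᵥ u = p ⬝ᵥ u := by
    rw [dotProduct_mulVec, hp, mulVec_transpose]
  rw [fromBlocks_transpose, fromBlocks_mulVec] at hLw
  simp only [Sum.elim_comp_inl, Sum.elim_comp_inr, transpose_zero, zero_mulVec, zero_add,
    transpose_one, one_mulVec, sumElim_dotProduct_sumElim] at hLw hw
  change (v + p) ⬝ᵥ (v + p) + y ⬝ᵥ y = _ at hLw
  have hpp := hbound p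
  have hpu := hbound (v + p)
  rw [hyp] at hpp hpu
  have hpp' := (le_abs_self _).trans hpp
  have hvv : v ⬝ᵥ v = (v + p) ⬝ᵥ (v + p) - 2 * (p ⬝ᵥ (v + p)) + p ⬝ᵥ p := by
    simp only [add_dotProduct, dotProduct_add, dotProduct_comm v p]
    ring
  have hpu' := (neg_le_abs _).trans hpu
  have hP := Real.sq_sqrt (real_dotProduct_self_nonneg p)
  have hU := Real.sq_sqrt (real_dotProduct_self_nonneg (v + p))
  have hY := Real.sq_sqrt (real_dotProduct_self_nonneg y)
  have hP0 := Real.sqrt_nonneg (p ⬝ᵥ p)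
  have hU0 := Real.sqrt_nonneg ((v + p) ⬝ᵥ (v + p))
  have hY0 := Real.sqrt_nonneg (y ⬝ᵥ y)
  have hxx := real_dotProduct_self_nonneg x
  have hyy := real_dotProduct_self_nonneg y
  generalize √(p ⬝ᵥ p) = P at *
  generalize √((v + p) ⬝ᵥ (v + p)) = U at *
  generalize √(y ⬝ᵥ y) = Y at *
  have hPY : P ≤ l * Y := by
    rcases hP0.eq_or_lt with h | h
    · rw [← h]; positivity
    · exact le_of_mul_le_mul_left (by linarith [hP, hpp']) h
  have hPY2 : P ^ 2 ≤ (l * Y) ^ 2 := pow_le_pow_left₀ hP0 hPY 2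
  have hub : v ⬝ᵥ v + y ⬝ᵥ y ≤ (1 + l) ^ 2 * (σ ^ 2 * (x ⬝ᵥ x + y ⬝ᵥ y)) := by
    rw [hvv, ← hLw, ← hU, ← hY, ← hP]
    nlinarith [mul_nonneg hl (sq_nonneg (U - Y)), mul_nonneg hl (sq_nonneg U),
      mul_nonneg hl (sq_nonneg Y), mul_nonneg (sq_nonneg l) (sq_nonneg U)]
  have ht0 : 0 ≤ min σm 1 := le_min hs zero_le_one
  have ht1 : (min σm 1) ^ 2 ≤ σm ^ 2 := pow_le_pow_left₀ ht0 (min_le_left _ _) 2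
  have ht2 : (min σm 1) ^ 2 ≤ 1 := pow_le_one₀ ht0 (min_le_right _ _)
  have hlb : (min σm 1) ^ 2 * (x ⬝ᵥ x + y ⬝ᵥ y) ≤ v ⬝ᵥ v + y ⬝ᵥ y := by
    nlinarith [mul_le_mul_of_nonneg_right ht1 hxx, mul_le_mul_of_nonneg_right ht2 hyy]
  have hsq : (min σm 1) ^ 2 ≤ (σ * (1 + l)) ^ 2 :=
    le_of_mul_le_mul_right (by linarith) hw
  rw [div_le_iff₀ (by positivity)]
  exact (le_abs_self _).trans (abs_le_of_sq_le_sq hsq (by positivity))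
end

section
/- (Singular-value bounds for the Fourier symbol matrix of the penalized diffusive relaxation scheme.) Let τ, h > 0 with τ ≤ 1, set β = τ/h and β̃ = τ/h², and assume β ≤ 1/2. Let N_t ≥ 2 with τ·N_t = 1, let ε ≥ 0, let k be a real number, and write s² = sin²(kh/2). Define the complex scalars c₁ = ( −1 − 4β̃s² + (2β + β²·(1−ε)/(τ+ε))·sin²(kh) ) / (1 + 4β̃s²), c₂ = i·(ε/(τ+ε))·β·sin(kh), d₁ = (ε/(τ+ε))·2β·s², d₂ = i·( β − 2β²·((1−ε)/(τ+ε))·sin²(kh) )·sin(kh) / (1 + 4β̃s²). Let L̂ be the 2N_t×2N_t complex matrix with 2×2 block structure L̂ = [[T(1, c₁), S(c₂)],[S(d₂), T(1, d₁)]], where T(1, x) denotes the N_t×N_t lower-bidiagonal matrix with 1 on the diagonal and x on the first subdiagonal, and S(x) the N_t×N_t matrix with x on the first subdiagonal and 0 elsewhere. Set α = (ε/(τ+ε))·(2+4τ)/τ. Then every singular value σ of L̂ satisfies τ/3 − α ≤ σ ≤ 4 + α. -/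
open Matrix Real

/-- `T x`: the `Nt × Nt` lower-bidiagonal complex matrix with `1` on the main diagonal
and `x` on the first subdiagonal. -/
def lowerBidiagT {Nt : ℕ} (x : ℂ) : Matrix (Fin Nt) (Fin Nt) ℂ :=
  fun i j => if i = j then 1 else if (i : ℕ) = (j : ℕ) + 1 then x else 0

/-- `S x`: the `Nt × Nt` complex matrix with `x` on the first subdiagonal and `0`
elsewhere. -/
def subdiagS {Nt : ℕ} (x : ℂ) : Matrix (Fin Nt) (Fin Nt) ℂ :=
  fun i j => if (i : ℕ) = (j : ℕ) + 1 then x else 0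

lemma IsSingularValue.exists_norm_mulVec_eq {𝕜 n : Type*} [RCLike 𝕜] [Fintype n] [DecidableEq n]
    {M : Matrix n n 𝕜} {σ : ℝ} (hσ : IsSingularValue M σ) :
    ∃ w : n → 𝕜, w ≠ 0 ∧ ‖WithLp.toLp 2 (M *ᵥ w)‖ = σ * ‖WithLp.toLp 2 w‖ := by
  obtain ⟨hσ0, hσ⟩ := hσ
  rw [Matrix.mem_spectrum_iff_isRoot_charpoly, Matrix.charpoly_mul_comm,
    ← Matrix.mem_spectrum_iff_isRoot_charpoly, ← Matrix.spectrum_toLin',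
    ← Module.End.hasEigenvalue_iff_mem_spectrum] at hσ
  obtain ⟨w, hw⟩ := hσ.exists_hasEigenvector
  refine ⟨w, hw.2, ?_⟩
  have hMw : (Mᴴ * M) *ᵥ w = (algebraMap ℝ 𝕜 (σ ^ 2)) • w := by
    simpa [Matrix.toLin'_apply] using hw.apply_eq_smul
  have hdot : star (M *ᵥ w) ⬝ᵥ (M *ᵥ w) = algebraMap ℝ 𝕜 (σ ^ 2) * (star w ⬝ᵥ w) := by
    rw [Matrix.star_mulVec, ← Matrix.dotProduct_mulVec, Matrix.mulVec_mulVec, hMw,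
      dotProduct_smul, smul_eq_mul]
  have hnorm (v : n → 𝕜) : star v ⬝ᵥ v = ((‖WithLp.toLp 2 v‖ ^ 2 : ℝ) : 𝕜) := by
    rw [EuclideanSpace.norm_sq_eq]
    simp [dotProduct, RCLike.conj_mul]
  rw [hnorm, hnorm, RCLike.algebraMap_eq_ofReal, ← RCLike.ofReal_mul, RCLike.ofReal_inj,
    ← mul_pow] at hdot
  exact (sq_eq_sq₀ (norm_nonneg _) (by positivity)).1 hdot

lemma norm_sq_toLp_sumElim {m n : Type*} [Fintype m] [Fintype n] (u : m → ℂ) (v : n → ℂ) :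
    ‖WithLp.toLp 2 (Sum.elim u v)‖ ^ 2 = ‖WithLp.toLp 2 u‖ ^ 2 + ‖WithLp.toLp 2 v‖ ^ 2 := by
  simp [EuclideanSpace.norm_sq_eq]

lemma norm_toLp_sumElim_le {m n : Type*} [Fintype m] [Fintype n] (u : m → ℂ) (v : n → ℂ) :
    ‖WithLp.toLp 2 (Sum.elim u v)‖ ≤ ‖WithLp.toLp 2 u‖ + ‖WithLp.toLp 2 v‖ := by
  refine le_of_sq_le_sq ?_ (by positivity)
  rw [norm_sq_toLp_sumElim]
  nlinarith [mul_nonneg (norm_nonneg (WithLp.toLp 2 u)) (norm_nonneg (WithLp.toLp 2 v))]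

lemma subdiagS_eq_smul {N : ℕ} (x : ℂ) :
    (subdiagS x : Matrix (Fin N) (Fin N) ℂ) = x • subdiagS 1 := by
  ext i j
  simp [subdiagS]

lemma subdiagS_add {N : ℕ} (x y : ℂ) :
    (subdiagS (x + y) : Matrix (Fin N) (Fin N) ℂ) = subdiagS x + subdiagS y := by
  rw [subdiagS_eq_smul, add_smul, ← subdiagS_eq_smul, ← subdiagS_eq_smul]

lemma lowerBidiagT_eq {N : ℕ} (x : ℂ) :
    (lowerBidiagT x : Matrix (Fin N) (Fin N) ℂ) = 1 + subdiagS x := by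
  ext i j
  by_cases hij : i = j
  · simp [lowerBidiagT, subdiagS, hij]
  · simp [lowerBidiagT, subdiagS, hij]

lemma subdiagS_one_mulVec_zero {n : ℕ} (u : Fin (n + 1) → ℂ) : (subdiagS 1 *ᵥ u) 0 = 0 := by
  simp [Matrix.mulVec, dotProduct, subdiagS]

lemma subdiagS_one_mulVec_succ {n : ℕ} (u : Fin (n + 1) → ℂ) (i : Fin n) :
    (subdiagS 1 *ᵥ u) i.succ = u i.castSucc := by
  rw [Matrix.mulVec, dotProduct, Finset.sum_eq_single i.castSucc]
  · simp [subdiagS]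
  · intro j _ hj
    have : (i : ℕ) ≠ j := fun h => hj (Fin.ext h.symm)
    simp [subdiagS, this]
  · simp

lemma norm_subdiagS_one_mulVec_le {N : ℕ} (u : Fin N → ℂ) :
    ‖WithLp.toLp 2 (subdiagS 1 *ᵥ u)‖ ≤ ‖WithLp.toLp 2 u‖ := by
  refine le_of_sq_le_sq ?_ (norm_nonneg _)
  rw [EuclideanSpace.norm_sq_eq, EuclideanSpace.norm_sq_eq]
  cases N with
  | zero => simp
  | succ n =>
    rw [Fin.sum_univ_succ, Fin.sum_univ_castSucc]
    simp [subdiagS_one_mulVec_zero, subdiagS_one_mulVec_succ]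

lemma norm_subdiagS_mulVec_le {N : ℕ} (x : ℂ) (u : Fin N → ℂ) :
    ‖WithLp.toLp 2 (subdiagS x *ᵥ u)‖ ≤ ‖x‖ * ‖WithLp.toLp 2 u‖ := by
  rw [subdiagS_eq_smul, Matrix.smul_mulVec, WithLp.toLp_smul, norm_smul]
  gcongr
  exact norm_subdiagS_one_mulVec_le u

lemma subdiagS_pow_mulVec_apply {N : ℕ} (x : ℂ) (u : Fin N → ℂ) (m : ℕ) (i : Fin N)
    (hi : (i : ℕ) < m) : ((subdiagS x ^ m) *ᵥ u) i = 0 := by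
  induction m generalizing i with
  | zero => omega
  | succ m ih =>
    rw [pow_succ', ← Matrix.mulVec_mulVec, Matrix.mulVec, dotProduct]
    refine Finset.sum_eq_zero fun j _ => ?_
    by_cases hij : (i : ℕ) = j + 1
    · rw [ih j (by omega), mul_zero]
    · simp [subdiagS, hij]

lemma norm_le_mul_norm_lowerBidiagT_mulVec {N : ℕ} {x : ℂ} (hx : ‖x‖ ≤ 1) (u : Fin N → ℂ) :
    ‖WithLp.toLp 2 u‖ ≤ N * ‖WithLp.toLp 2 (lowerBidiagT x *ᵥ u)‖ := by
  set f := lowerBidiagT x *ᵥ u with hf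
  have hpow (m : ℕ) : ‖WithLp.toLp 2 ((subdiagS (-x) ^ m) *ᵥ f)‖ ≤ ‖WithLp.toLp 2 f‖ := by
    induction m with
    | zero => simp
    | succ m ih =>
      rw [pow_succ', ← Matrix.mulVec_mulVec]
      refine (norm_subdiagS_mulVec_le _ _).trans ?_
      rw [norm_neg]
      nlinarith [norm_nonneg (WithLp.toLp 2 ((subdiagS (-x) ^ m) *ᵥ f))]
  have hT : (lowerBidiagT x : Matrix (Fin N) (Fin N) ℂ) = 1 - subdiagS (-x) := by
    rw [lowerBidiagT_eq, subdiagS_eq_smul, subdiagS_eq_smul (-x)]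
    simp
  have hu : u = ∑ m ∈ Finset.range N, (subdiagS (-x) ^ m) *ᵥ f := by
    rw [hf, ← Matrix.sum_mulVec, Matrix.mulVec_mulVec, hT, geom_sum_mul_neg, Matrix.sub_mulVec,
      Matrix.one_mulVec]
    ext i
    simp [subdiagS_pow_mulVec_apply (-x) u N i i.2]
  calc ‖WithLp.toLp 2 u‖ = ‖∑ m ∈ Finset.range N, WithLp.toLp 2 ((subdiagS (-x) ^ m) *ᵥ f)‖ := by
        conv_lhs => rw [hu]
        rw [WithLp.toLp_sum]
    _ ≤ ∑ m ∈ Finset.range N, ‖WithLp.toLp 2 f‖ := norm_sum_le_of_le _ fun m _ => hpow m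
    _ = N * ‖WithLp.toLp 2 f‖ := by simp

section BlockBounds

variable {N : ℕ} (u v : Fin N → ℂ)

lemma norm_left_le_norm_sumElim : ‖WithLp.toLp 2 u‖ ≤ ‖WithLp.toLp 2 (Sum.elim u v)‖ := by
  refine le_of_sq_le_sq ?_ (norm_nonneg _)
  rw [norm_sq_toLp_sumElim]
  linarith [sq_nonneg ‖WithLp.toLp 2 v‖]

lemma norm_right_le_norm_sumElim : ‖WithLp.toLp 2 v‖ ≤ ‖WithLp.toLp 2 (Sum.elim u v)‖ := by
  refine le_of_sq_le_sq ?_ (norm_nonneg _)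
  rw [norm_sq_toLp_sumElim]
  linarith [sq_nonneg ‖WithLp.toLp 2 u‖]

lemma norm_fromBlocks_subdiagS_mulVec_le (a b c d : ℂ) :
    ‖WithLp.toLp 2 (fromBlocks (subdiagS a) (subdiagS b) (subdiagS c) (subdiagS d) *ᵥ
      Sum.elim u v)‖ ≤ (‖a‖ + ‖b‖ + ‖c‖ + ‖d‖) * ‖WithLp.toLp 2 (Sum.elim u v)‖ := by
  rw [Matrix.fromBlocks_mulVec, Sum.elim_comp_inl, Sum.elim_comp_inr]
  refine (norm_toLp_sumElim_le _ _).trans ?_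
  rw [WithLp.toLp_add, WithLp.toLp_add]
  have hu := norm_left_le_norm_sumElim u v
  have hv := norm_right_le_norm_sumElim u v
  have bound (x : ℂ) {y : Fin N → ℂ}
      (hy : ‖WithLp.toLp 2 y‖ ≤ ‖WithLp.toLp 2 (Sum.elim u v)‖) :
      ‖WithLp.toLp 2 (subdiagS x *ᵥ y)‖ ≤ ‖x‖ * ‖WithLp.toLp 2 (Sum.elim u v)‖ :=
    (norm_subdiagS_mulVec_le x y).trans (by gcongr)
  linarith [norm_add_le (WithLp.toLp 2 (subdiagS a *ᵥ u)) (WithLp.toLp 2 (subdiagS b *ᵥ v)),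
    norm_add_le (WithLp.toLp 2 (subdiagS c *ᵥ u)) (WithLp.toLp 2 (subdiagS d *ᵥ v)),
    bound a hu, bound b hv, bound c hu, bound d hv]

lemma norm_fromBlocks_lowerBidiagT_mulVec_le {c d : ℂ} (hc : ‖c‖ ≤ 1) (hd : ‖d‖ ≤ 2) :
    ‖WithLp.toLp 2 (fromBlocks (lowerBidiagT c) 0 (subdiagS d) 1 *ᵥ Sum.elim u v)‖
      ≤ 4 * ‖WithLp.toLp 2 (Sum.elim u v)‖ := by
  have hsplit : (fromBlocks (lowerBidiagT c) 0 (subdiagS d) 1 :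
      Matrix (Fin N ⊕ Fin N) (Fin N ⊕ Fin N) ℂ) =
      1 + fromBlocks (subdiagS c) (subdiagS 0) (subdiagS d) (subdiagS 0) := by
    rw [← Matrix.fromBlocks_one, Matrix.fromBlocks_add, lowerBidiagT_eq, subdiagS_eq_smul 0]
    simp
  rw [hsplit, Matrix.add_mulVec, Matrix.one_mulVec, WithLp.toLp_add]
  refine (norm_add_le _ _).trans ?_
  have h := norm_fromBlocks_subdiagS_mulVec_le u v c 0 d 0
  rw [norm_zero] at h
  nlinarith [norm_nonneg (WithLp.toLp 2 (Sum.elim u v))]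

lemma le_norm_fromBlocks_lowerBidiagT_mulVec {c d : ℂ} {τ : ℝ} (hτ0 : 0 < τ) (hτ1 : τ ≤ 1)
    (hτN : τ * N = 1) (hc : ‖c‖ ≤ 1) (hd : ‖d‖ ≤ 2) :
    τ / 3 * ‖WithLp.toLp 2 (Sum.elim u v)‖ ≤
      ‖WithLp.toLp 2 (fromBlocks (lowerBidiagT c) 0 (subdiagS d) 1 *ᵥ Sum.elim u v)‖ := by
  rw [Matrix.fromBlocks_mulVec, Sum.elim_comp_inl, Sum.elim_comp_inr, Matrix.zero_mulVec,
    Matrix.one_mulVec, add_zero]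
  have hf := norm_le_mul_norm_lowerBidiagT_mulVec hc u
  set f := lowerBidiagT c *ᵥ u
  set g := subdiagS d *ᵥ u + v with hg
  have hv : ‖WithLp.toLp 2 v‖ ≤ ‖WithLp.toLp 2 g‖ + 2 * ‖WithLp.toLp 2 u‖ := by
    have : WithLp.toLp 2 v = WithLp.toLp 2 g - WithLp.toLp 2 (subdiagS d *ᵥ u) := by
      rw [hg, ← WithLp.toLp_sub, add_sub_cancel_left]
    rw [this]
    refine (norm_sub_le _ _).trans (add_le_add_right ?_ _)
    exact (norm_subdiagS_mulVec_le d u).trans (by gcongr)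
  have hu : τ * ‖WithLp.toLp 2 u‖ ≤ ‖WithLp.toLp 2 f‖ := by
    calc τ * ‖WithLp.toLp 2 u‖ ≤ τ * (N * ‖WithLp.toLp 2 f‖) := by gcongr
      _ = ‖WithLp.toLp 2 f‖ := by rw [← mul_assoc, hτN, one_mul]
  have hv' : τ * ‖WithLp.toLp 2 v‖ ≤ ‖WithLp.toLp 2 g‖ + 2 * ‖WithLp.toLp 2 f‖ := by
    nlinarith [norm_nonneg (WithLp.toLp 2 g)]
  have hu2 := pow_le_pow_left₀ (by positivity) hu 2
  have hv2 := pow_le_pow_left₀ (by positivity) hv' 2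
  refine le_of_sq_le_sq ?_ (norm_nonneg _)
  rw [mul_pow, norm_sq_toLp_sumElim, norm_sq_toLp_sumElim]
  nlinarith [sq_nonneg (2 * ‖WithLp.toLp 2 f‖ - ‖WithLp.toLp 2 g‖),
    sq_nonneg ‖WithLp.toLp 2 g‖]

end BlockBounds

lemma limitSymbol_bounds {β y b p S : ℝ} (hβ0 : 0 ≤ β) (hβ : β ≤ 1 / 2) (hy : 0 ≤ y)
    (hp0 : 0 ≤ p) (hp1 : p ≤ 1) (hyp : y = 4 * b * p) (hS : S ^ 2 = 4 * p * (1 - p)) :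
    |(-1 - y + (2 * β + b) * S ^ 2) / (1 + y)| ≤ 1 ∧
      |(β - 2 * b * S ^ 2) * S / (1 + y)| ≤ 2 := by
  have hD : 0 < 1 + y := by linarith
  have hbS : b * S ^ 2 = y * (1 - p) := by rw [hS, hyp]; ring
  have hyp0 : 0 ≤ y * p := mul_nonneg hy hp0
  have hyq : 0 ≤ y * (1 - p) := mul_nonneg hy (by linarith)
  have hS1 : S ^ 2 ≤ 1 := by nlinarith [sq_nonneg (2 * p - 1)]
  have hβS : β * S ^ 2 ≤ 1 / 2 := by nlinarith [sq_nonneg S]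
  have hβS0 : 0 ≤ β * S ^ 2 := by positivity
  constructor
  · rw [abs_div, abs_of_pos hD, div_le_one hD, abs_le]
    constructor <;> nlinarith
  · rw [abs_div, abs_of_pos hD, div_le_iff₀ hD, abs_mul]
    have hS' : |S| ≤ 1 := (sq_le_one_iff_abs_le_one S).1 hS1
    have h : |β - 2 * b * S ^ 2| ≤ 2 * (1 + y) := by
      rw [abs_le]
      constructor <;> nlinarith
    nlinarith [abs_nonneg S, abs_nonneg (β - 2 * b * S ^ 2)]

lemma perturbation_norm_sum_le {x τ β p q S : ℝ} (hτ0 : 0 < τ) (hτ2 : τ ≤ 1 / 2) (hx0 : 0 ≤ x)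
    (hβ0 : 0 ≤ β) (hβ : β ≤ 1 / 2) (hp0 : 0 ≤ p) (hp1 : p ≤ 1) (hq0 : 0 ≤ q) (hq1 : q ≤ 1)
    (hS1 : |S| ≤ 1) :
    ‖((-(x * (1 + τ) * q) : ℝ) : ℂ)‖ + ‖Complex.I * ((x * β * S : ℝ) : ℂ)‖ +
      ‖Complex.I * ((x * (1 + τ) * (2 * q * S) : ℝ) : ℂ)‖ + ‖((x * 2 * β * p : ℝ) : ℂ)‖ ≤
      x * (2 + 4 * τ) / τ := by
  have hτ' : 0 ≤ 1 + τ := by linarith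
  simp only [norm_mul, norm_neg, Complex.norm_I, one_mul, Complex.norm_real, Real.norm_eq_abs,
    abs_two, abs_of_nonneg hx0, abs_of_nonneg hτ', abs_of_nonneg hβ0,
    abs_of_nonneg hp0, abs_of_nonneg hq0]
  calc x * (1 + τ) * q + x * β * |S| + x * (1 + τ) * (2 * q * |S|) + x * 2 * β * p
      ≤ x * (1 + τ) * 1 + x * (1 / 2) * 1 + x * (1 + τ) * (2 * 1 * 1) + x * 2 * (1 / 2) * 1 := by
        gcongr
    _ = x * (9 / 2 + 3 * τ) := by ring
    _ ≤ x * (2 + 4 * τ) / τ := by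
        rw [mul_div_assoc]
        gcongr
        rw [le_div_iff₀ hτ0]
        nlinarith

lemma IsSingularValue.bounds_of_perturbation {N : ℕ} {c d a₁ a₂ b₁ b₂ : ℂ} {τ α σ : ℝ}
    (hσ : IsSingularValue (fromBlocks (lowerBidiagT c) 0 (subdiagS d) 1 +
      fromBlocks (subdiagS a₁) (subdiagS a₂) (subdiagS b₁) (subdiagS b₂) :
        Matrix (Fin N ⊕ Fin N) (Fin N ⊕ Fin N) ℂ) σ)
    (hτ0 : 0 < τ) (hτ1 : τ ≤ 1) (hτN : τ * N = 1) (hc : ‖c‖ ≤ 1) (hd : ‖d‖ ≤ 2)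
    (hsum : ‖a₁‖ + ‖a₂‖ + ‖b₁‖ + ‖b₂‖ ≤ α) : τ / 3 - α ≤ σ ∧ σ ≤ 4 + α := by
  obtain ⟨w, hw0, hw⟩ := hσ.exists_norm_mulVec_eq
  obtain ⟨u, v, rfl⟩ : ∃ u v, w = Sum.elim u v :=
    ⟨w ∘ Sum.inl, w ∘ Sum.inr, (Sum.elim_comp_inl_inr w).symm⟩
  have hwpos : 0 < ‖WithLp.toLp 2 (Sum.elim u v)‖ := by
    rw [norm_pos_iff]
    simpa using hw0
  have hupper := norm_fromBlocks_lowerBidiagT_mulVec_le u v hc hd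
  have hlower := le_norm_fromBlocks_lowerBidiagT_mulVec u v hτ0 hτ1 hτN hc hd
  have hpert := (norm_fromBlocks_subdiagS_mulVec_le u v a₁ a₂ b₁ b₂).trans
    (mul_le_mul_of_nonneg_right hsum hwpos.le)
  rw [Matrix.add_mulVec, WithLp.toLp_add] at hw
  constructor
  · refine le_of_mul_le_mul_right ?_ hwpos
    rw [sub_mul, ← hw]
    refine le_trans ?_ (norm_sub_le_norm_add _ _)
    linarith
  · refine le_of_mul_le_mul_right ?_ hwpos
    rw [add_mul, ← hw]
    exact (norm_add_le _ _).trans (add_le_add hupper hpert)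

/-- **Singular-value bounds for the Fourier symbol matrix of the penalized diffusive
relaxation scheme.** With `β = τ/h ≤ 1/2`, `β̃ = τ/h²`, `s² = sin²(kh/2)`,
the scalars `c₁, c₂, d₁, d₂` as in the scheme's Fourier analysis, and
`L̂ = [[T(1,c₁), S(c₂)], [S(d₂), T(1,d₁)]]`, every singular value `σ` of `L̂` satisfies
`τ/3 - α ≤ σ ≤ 4 + α`, where `α = (ε/(τ+ε))·(2+4τ)/τ`. -/
theorem stmt17 (Nt : ℕ) (hNt : 2 ≤ Nt) (τ h β βt ε k α : ℝ)
    (hτ0 : 0 < τ) (hτ1 : τ ≤ 1) (hh0 : 0 < h)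
    (hβ : β = τ / h) (hβt : βt = τ / h ^ 2) (hβ12 : β ≤ 1 / 2)
    (hτNt : τ * Nt = 1) (hε : 0 ≤ ε)
    (hα : α = (ε / (τ + ε)) * (2 + 4 * τ) / τ)
    (c₁ c₂ d₁ d₂ : ℂ)
    (hc₁ : c₁ = (((-1 - 4 * βt * Real.sin (k * h / 2) ^ 2
        + (2 * β + β ^ 2 * (1 - ε) / (τ + ε)) * Real.sin (k * h) ^ 2)
        / (1 + 4 * βt * Real.sin (k * h / 2) ^ 2) : ℝ) : ℂ))
    (hc₂ : c₂ = Complex.I * (((ε / (τ + ε)) * β * Real.sin (k * h) : ℝ) : ℂ))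
    (hd₁ : d₁ = (((ε / (τ + ε)) * 2 * β * Real.sin (k * h / 2) ^ 2 : ℝ) : ℂ))
    (hd₂ : d₂ = Complex.I * ((((β - 2 * β ^ 2 * ((1 - ε) / (τ + ε)) * Real.sin (k * h) ^ 2)
        * Real.sin (k * h)) / (1 + 4 * βt * Real.sin (k * h / 2) ^ 2) : ℝ) : ℂ))
    (Lhat : Matrix (Fin Nt ⊕ Fin Nt) (Fin Nt ⊕ Fin Nt) ℂ)
    (hLhat : Lhat = Matrix.fromBlocks
      (lowerBidiagT c₁) (subdiagS c₂) (subdiagS d₂) (lowerBidiagT d₁)) :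
    ∀ σ : ℝ, IsSingularValue Lhat σ → τ / 3 - α ≤ σ ∧ σ ≤ 4 + α := by
  intro σ hσ
  set p := Real.sin (k * h / 2) ^ 2 with hp
  set S := Real.sin (k * h) with hS
  set x := ε / (τ + ε) with hx
  set y := 4 * βt * p with hy
  have hτε : 0 < τ + ε := by linarith
  have hx0 : 0 ≤ x := by positivity
  have hβ0 : 0 ≤ β := by rw [hβ]; positivity
  have hp0 : 0 ≤ p := sq_nonneg _
  have hp1 : p ≤ 1 := Real.sin_sq_le_one _
  have hβt0 : 0 ≤ βt := by rw [hβt]; positivity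
  have hy0 : 0 ≤ y := by positivity
  have hSp : S ^ 2 = 4 * p * (1 - p) := by
    rw [hS, hp, show k * h = 2 * (k * h / 2) by ring, Real.sin_two_mul, mul_pow, mul_pow,
      Real.cos_sq']
    ring_nf
  have hββ : β ^ 2 = βt * τ := by rw [hβ, hβt]; field_simp
  have hτ2 : τ ≤ 1 / 2 := by
    have : (2 : ℝ) ≤ Nt := by exact_mod_cast hNt
    nlinarith
  have hD : 0 < 1 + y := by linarith
  obtain ⟨hc, hd⟩ := limitSymbol_bounds hβ0 hβ12 hy0 hp0 hp1 hy hSp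
  set c := (-1 - y + (2 * β + βt) * S ^ 2) / (1 + y) with hcdef
  set d := (β - 2 * βt * S ^ 2) * S / (1 + y) with hddef
  have hpen : β ^ 2 * (1 - ε) / (τ + ε) = βt - x * (1 + τ) * βt := by
    rw [hββ, hx]
    field_simp
    ring
  have hc₁' : c₁ = (c : ℂ) + ((-(x * (1 + τ) * (βt * S ^ 2 / (1 + y))) : ℝ) : ℂ) := by
    rw [hc₁, hpen, ← Complex.ofReal_add, hcdef]
    congr 1
    field_simp
    ring
  have hd₂' : d₂ = Complex.I * (d : ℂ) +
      Complex.I * ((x * (1 + τ) * (2 * (βt * S ^ 2 / (1 + y)) * S) : ℝ) : ℂ) := by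
    rw [hd₂, ← mul_add, ← Complex.ofReal_add, hddef, mul_assoc 2 (β ^ 2), ← mul_div_assoc (β ^ 2),
      hpen]
    congr 2
    field_simp
    ring
  have hq0 : 0 ≤ βt * S ^ 2 / (1 + y) := by positivity
  have hq1 : βt * S ^ 2 / (1 + y) ≤ 1 := by
    rw [div_le_one hD, hSp]
    nlinarith [mul_nonneg hy0 hp0]
  set q := βt * S ^ 2 / (1 + y)
  have hS1 : |S| ≤ 1 := Real.abs_sin_le_one _
  set c' : ℂ := ((-(x * (1 + τ) * q) : ℝ) : ℂ) with hc'
  set d' : ℂ := Complex.I * ((x * (1 + τ) * (2 * q * S) : ℝ) : ℂ) with hd'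
  have hsum : ‖c'‖ + ‖c₂‖ + ‖d'‖ + ‖d₁‖ ≤ α := by
    rw [hc', hd', hc₂, hd₁, hα]
    exact perturbation_norm_sum_le hτ0 hτ2 hx0 hβ0 hβ12 hp0 hp1 hq0 hq1 hS1
  have hL : Lhat = fromBlocks (lowerBidiagT (c : ℂ)) 0 (subdiagS (Complex.I * (d : ℂ))) 1 +
      fromBlocks (subdiagS c') (subdiagS c₂) (subdiagS d') (subdiagS d₁) := by
    rw [hLhat, hc₁', hd₂', Matrix.fromBlocks_add, lowerBidiagT_eq, lowerBidiagT_eq,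
      lowerBidiagT_eq, subdiagS_add, subdiagS_add, zero_add, add_assoc]
  have hcn : ‖(c : ℂ)‖ ≤ 1 := by rwa [Complex.norm_real]
  have hdn : ‖Complex.I * (d : ℂ)‖ ≤ 2 := by
    rwa [norm_mul, Complex.norm_I, one_mul, Complex.norm_real]
  rw [hL] at hσ
  exact hσ.bounds_of_perturbation hτ0 hτ1 hτNt hcn hdn hsum
end

section
/- Let β and β̃ be real numbers with 0 ≤ β ≤ 1/2 and β̃ ≥ 0, and let x be any real number. Then 0 ≤ (2β + β̃)·sin²(x) ≤ 1 + 4β̃·sin²(x/2), and consequently |1 − (2β + β̃)·sin²(x)/(1 + 4β̃·sin²(x/2))| ≤ 1. -/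
/-- The double-angle bound `sin² x ≤ 4 sin² (x / 2)`. -/
theorem sin_sq_le_four_mul_sin_half_sq (x : ℝ) :
    Real.sin x ^ 2 ≤ 4 * Real.sin (x / 2) ^ 2 := by
  have h : Real.sin x = 2 * Real.sin (x / 2) * Real.cos (x / 2) := by
    rw [← Real.sin_two_mul, mul_div_cancel₀ x two_ne_zero]
  calc Real.sin x ^ 2 = 4 * Real.sin (x / 2) ^ 2 * Real.cos (x / 2) ^ 2 := by rw [h]; ring
    _ ≤ 4 * Real.sin (x / 2) ^ 2 :=
      mul_le_of_le_one_right (by positivity) (Real.cos_sq_le_one _)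

/-- **Amplification-factor bound for the penalized diffusive relaxation scheme.**
For `0 ≤ β ≤ 1/2`, `β̃ ≥ 0` and any real `x`:
`0 ≤ (2β + β̃)·sin²x ≤ 1 + 4β̃·sin²(x/2)`, and consequently
`|1 - (2β + β̃)·sin²x / (1 + 4β̃·sin²(x/2))| ≤ 1`. -/
theorem stmt18 (β βt x : ℝ) (hβ0 : 0 ≤ β) (hβ1 : β ≤ 1 / 2) (hβt : 0 ≤ βt) :
    (0 ≤ (2 * β + βt) * Real.sin x ^ 2 ∧
      (2 * β + βt) * Real.sin x ^ 2 ≤ 1 + 4 * βt * Real.sin (x / 2) ^ 2) ∧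
    |1 - (2 * β + βt) * Real.sin x ^ 2 / (1 + 4 * βt * Real.sin (x / 2) ^ 2)| ≤ 1 := by
  have hnonneg : 0 ≤ (2 * β + βt) * Real.sin x ^ 2 := by positivity
  have hle : (2 * β + βt) * Real.sin x ^ 2 ≤ 1 + 4 * βt * Real.sin (x / 2) ^ 2 := by
    have h₁ : 2 * β * Real.sin x ^ 2 ≤ 1 :=
      mul_le_one₀ (by linarith) (sq_nonneg _) (Real.sin_sq_le_one x)
    have h₂ := mul_le_mul_of_nonneg_left (sin_sq_le_four_mul_sin_half_sq x) hβt
    linarith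
  have hpos : 0 < 1 + 4 * βt * Real.sin (x / 2) ^ 2 := by positivity
  refine ⟨⟨hnonneg, hle⟩, ?_⟩
  have hquot_nonneg := div_nonneg hnonneg hpos.le
  have hquot_le := (div_le_one hpos).2 hle
  exact abs_le.2 ⟨by linarith, by linarith⟩
end

section
/- (Stability of the explicit scheme's amplification matrix.) Let δ ∈ (0, 1], let c_p be a real number with 1/√111 ≤ c_p ≤ 2/(2+δ), let a ∈ [0, 1], and let s ∈ {+1, −1}. Define the complex 2×2 matrix à = [[1 − 2c_p·a², s·i·2c_p·a·√(1−a²)],[s·i·2c_p·a·√(1−a²), 1 − 2c_p·a² − c_p·δ]]. Then ‖Ã‖ ≤ 1, where ‖·‖ is the spectral norm (i.e. both eigenvalues μ of ÃÃᴴ satisfy |μ| ≤ 1). -/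
open Matrix

open scoped Matrix.Norms.L2Operator in
theorem specNorm_eq_l2_opNorm (M : Matrix (Fin 2) (Fin 2) ℂ) : specNorm M = ‖M‖ := rfl

open scoped Matrix.Norms.L2Operator in
/-- Eigenvalues of `M * Mᴴ` are bounded by the squared spectral norm of `M`. -/
theorem norm_le_specNorm_sq_of_mem_spectrum (M : Matrix (Fin 2) (Fin 2) ℂ) {μ : ℂ}
    (hμ : μ ∈ spectrum ℂ (M * Mᴴ)) : ‖μ‖ ≤ specNorm M ^ 2 := by
  calc ‖μ‖ ≤ ‖M * Mᴴ‖ := spectrum.norm_le_norm_of_mem hμ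
    _ ≤ ‖M‖ * ‖Mᴴ‖ := Matrix.l2_opNorm_mul M Mᴴ
    _ = specNorm M ^ 2 := by
      rw [Matrix.l2_opNorm_conjTranspose, specNorm_eq_l2_opNorm, sq]

theorem specNorm_le_one_of_normSq_le (M : Matrix (Fin 2) (Fin 2) ℂ)
    (h : ∀ u v : ℂ, Complex.normSq (M 0 0 * u + M 0 1 * v) +
      Complex.normSq (M 1 0 * u + M 1 1 * v) ≤ Complex.normSq u + Complex.normSq v) :
    specNorm M ≤ 1 := by
  refine ContinuousLinearMap.opNorm_le_bound _ zero_le_one fun x => ?_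
  rw [one_mul, EuclideanSpace.norm_eq, EuclideanSpace.norm_eq]
  apply Real.sqrt_le_sqrt
  simpa [Fin.sum_univ_two, Matrix.toLpLin_apply, Matrix.mulVec, dotProduct,
    Complex.normSq_eq_norm_sq] using h (x 0) (x 1)

theorem quadratic_form_nonneg {A B k : ℝ} (hA : 0 ≤ A) (hB : 0 ≤ B) (hk : k ^ 2 ≤ A * B)
    (x y : ℝ) : 0 ≤ A * x ^ 2 + 2 * k * x * y + B * y ^ 2 := by
  rcases hA.eq_or_lt with rfl | hA
  · have : k = 0 := by nlinarith
    subst this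
    nlinarith [mul_nonneg hB (sq_nonneg y)]
  · have : 0 ≤ A * (A * x ^ 2 + 2 * k * x * y + B * y ^ 2) := by
      nlinarith [sq_nonneg (A * x + k * y), mul_nonneg (sub_nonneg.2 hk) (sq_nonneg y)]
    exact nonneg_of_mul_nonneg_right this hA

/-- A symmetric `2 × 2` matrix with real diagonal and purely imaginary off-diagonal entries is a
contraction as soon as the diagonal entries and the determinant of `1 - M * Mᴴ` are nonnegative. -/
theorem specNorm_le_one_of_imaginary_offDiag {p q r : ℝ} (h1 : 0 ≤ 1 - p ^ 2 - q ^ 2)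
    (h2 : 0 ≤ 1 - q ^ 2 - r ^ 2)
    (hdet : (q * (p - r)) ^ 2 ≤ (1 - p ^ 2 - q ^ 2) * (1 - q ^ 2 - r ^ 2)) :
    specNorm !![(p : ℂ), Complex.I * q; Complex.I * q, (r : ℂ)] ≤ 1 := by
  refine specNorm_le_one_of_normSq_le _ fun u v => ?_
  have e1 := quadratic_form_nonneg h1 h2 hdet u.re v.im
  have e2 := quadratic_form_nonneg h1 h2 hdet u.im (-v.re)
  simp [Complex.normSq_apply]
  nlinarith

/-- **Von Neumann stability of the explicit scheme's amplification matrix.**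
For `δ ∈ (0,1]`, `1/√111 ≤ c_p ≤ 2/(2+δ)`, `a ∈ [0,1]` and `s ∈ {+1,-1}`, the rescaled
Fourier amplification matrix
`Ã = [[1 - 2c_p a², s·i·2c_p a·√(1-a²)], [s·i·2c_p a·√(1-a²), 1 - 2c_p a² - c_p δ]]`
has spectral norm at most `1`; equivalently both eigenvalues `μ` of `Ã·Ãᴴ` satisfy
`|μ| ≤ 1`. -/
theorem stmt19 (δ cp a s : ℝ) (hδ0 : 0 < δ) (hδ1 : δ ≤ 1)
    (hcp1 : 1 / Real.sqrt 111 ≤ cp) (hcp2 : cp ≤ 2 / (2 + δ))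
    (ha0 : 0 ≤ a) (ha1 : a ≤ 1) (hs : s = 1 ∨ s = -1)
    (Atilde : Matrix (Fin 2) (Fin 2) ℂ)
    (hAt : Atilde = !![((1 - 2 * cp * a ^ 2 : ℝ) : ℂ),
        (s : ℂ) * Complex.I * (2 * cp * a * Real.sqrt (1 - a ^ 2) : ℝ);
      (s : ℂ) * Complex.I * (2 * cp * a * Real.sqrt (1 - a ^ 2) : ℝ),
        ((1 - 2 * cp * a ^ 2 - cp * δ : ℝ) : ℂ)]) :
    specNorm Atilde ≤ 1 ∧
    ∀ μ ∈ spectrum ℂ (Atilde * Atildeᴴ), ‖μ‖ ≤ 1 := by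
  have hc0 : 0 ≤ cp := le_trans (by positivity) hcp1
  have hc2 : 0 ≤ 2 - cp * (2 + δ) := by
    rw [le_div_iff₀ (by linarith)] at hcp2
    linarith
  have hc1 : 0 ≤ 1 - cp := by nlinarith
  have hx0 : 0 ≤ a ^ 2 := sq_nonneg a
  have hx1 : 0 ≤ 1 - a ^ 2 := by nlinarith
  have hs2 : s ^ 2 = 1 := by rcases hs with rfl | rfl <;> norm_num
  set w := Real.sqrt (1 - a ^ 2)
  have hw : w ^ 2 = 1 - a ^ 2 := Real.sq_sqrt hx1
  set q := s * (2 * cp * a * w) with hq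
  have hq2 : q ^ 2 = 4 * cp ^ 2 * a ^ 2 * (1 - a ^ 2) := by
    rw [hq, ← hw]
    linear_combination (2 * cp * a * w) ^ 2 * hs2
  have hD1 : 1 - (1 - 2 * cp * a ^ 2) ^ 2 - q ^ 2 = 4 * cp * a ^ 2 * (1 - cp) := by
    rw [hq2]; ring
  -- the remaining quantities are affine in `a ^ 2`: interpolate between `0` and `1`
  have hD2 : 1 - q ^ 2 - (1 - 2 * cp * a ^ 2 - cp * δ) ^ 2 =
      cp * ((1 - a ^ 2) * (δ * (2 - cp * δ)) + a ^ 2 * ((2 + δ) * (2 - cp * (2 + δ)))) := by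
    rw [hq2]; ring
  have hcδ : 0 ≤ 2 - cp * δ := by nlinarith
  have hM : specNorm Atilde ≤ 1 := by
    have hA : Atilde = !![((1 - 2 * cp * a ^ 2 : ℝ) : ℂ), Complex.I * q;
        Complex.I * q, ((1 - 2 * cp * a ^ 2 - cp * δ : ℝ) : ℂ)] := by
      have hoff : (s : ℂ) * Complex.I * (2 * cp * a * w : ℝ) = Complex.I * q := by
        rw [hq, Complex.ofReal_mul s]; ring
      rw [hAt, hoff]
    rw [hA]
    apply specNorm_le_one_of_imaginary_offDiag
    · rw [hD1]; positivity
    · rw [hD2]; positivity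
    · rw [hD1, hD2, mul_pow, hq2, ← sub_nonneg]
      have hdet : 0 ≤ 4 * cp ^ 2 * a ^ 2 * ((1 - a ^ 2) * (δ * (2 - cp * (2 + δ))) +
          a ^ 2 * ((1 - cp) * ((2 + δ) * (2 - cp * (2 + δ))))) := by positivity
      refine hdet.trans_eq ?_
      ring
  refine ⟨hM, fun μ hμ => (norm_le_specNorm_sq_of_mem_spectrum _ hμ).trans ?_⟩
  exact pow_le_one₀ (norm_nonneg _) hM
end
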